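/- Let M be a simple 𝔤-supermodule. Then there exists a simple 𝔤₀-supermodule N such that M embeds as a 𝔤-supermodule into the coinduced module Coind_{𝔤≥0}^𝔤(N). -/

import Mathlib

noncomputable section

open Module Function

/-- A complex Lie superalgebra `𝔤 = 𝔤₀̄ ⊕ 𝔤₁̄` equipped with a compatible `ℤ`-grading
`𝔤 = 𝔤₋₁ ⊕ 𝔤₀ ⊕ 𝔤₁`, i.e. `𝔤₀ = 𝔤₀̄`, `𝔤₁̄ = 𝔤₁ ⊕ 𝔤₋₁`, the pieces `𝔤±₁` are
`𝔤₀̄`-submodules and `[𝔤₁,𝔤₁] = [𝔤₋₁,𝔤₋₁] = 0`.  The super skew-symmetry and the super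
Jacobi identity are imposed on (parity-)homogeneous elements, as usual. -/
structure GLSA where
  carrier : Type
  [isACG : AddCommGroup carrier]
  [isMod : Module ℂ carrier]
  bracket : carrier →ₗ[ℂ] carrier →ₗ[ℂ] carrier
  gneg : Submodule ℂ carrier
  g0 : Submodule ℂ carrier
  gpos : Submodule ℂ carrier
  oddCompl : IsCompl g0 (gneg ⊔ gpos)
  disjNP : Disjoint gneg gpos
  br_00 : ∀ x ∈ g0, ∀ y ∈ g0, bracket x y ∈ g0
  br_0p : ∀ x ∈ g0, ∀ y ∈ gpos, bracket x y ∈ gpos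
  br_0n : ∀ x ∈ g0, ∀ y ∈ gneg, bracket x y ∈ gneg
  br_pn : ∀ x ∈ gpos, ∀ y ∈ gneg, bracket x y ∈ g0
  br_pp : ∀ x ∈ gpos, ∀ y ∈ gpos, bracket x y = 0
  br_nn : ∀ x ∈ gneg, ∀ y ∈ gneg, bracket x y = 0
  skew_e : ∀ x ∈ g0, ∀ y, bracket x y = - bracket y x
  skew_oo : ∀ x ∈ gneg ⊔ gpos, ∀ y ∈ gneg ⊔ gpos, bracket x y = bracket y x
  jacobi_e : ∀ x y z : carrier, (x ∈ g0 ∨ y ∈ g0) →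
    bracket x (bracket y z) = bracket (bracket x y) z + bracket y (bracket x z)
  jacobi_oo : ∀ x ∈ gneg ⊔ gpos, ∀ y ∈ gneg ⊔ gpos, ∀ z,
    bracket x (bracket y z) = bracket (bracket x y) z - bracket y (bracket x z)

attribute [instance] GLSA.isACG GLSA.isMod

/-- The odd part `𝔤₁̄ = 𝔤₋₁ ⊕ 𝔤₁` of `L`. -/
def GLSA.odd (L : GLSA) : Submodule ℂ L.carrier := L.gneg ⊔ L.gpos

/-- A `𝔤`-supermodule: a `ℤ₂`-graded complex vector space with a compatible action of the
Lie superalgebra `L` (signs in the compatibility with the bracket are imposed on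
homogeneous elements). -/
structure SMod (L : GLSA) where
  carrier : Type
  [isACG : AddCommGroup carrier]
  [isMod : Module ℂ carrier]
  act : L.carrier →ₗ[ℂ] carrier →ₗ[ℂ] carrier
  ev : Submodule ℂ carrier
  od : Submodule ℂ carrier
  grading : IsCompl ev od
  act_e_ev : ∀ x ∈ L.g0, ∀ m ∈ ev, act x m ∈ ev
  act_e_od : ∀ x ∈ L.g0, ∀ m ∈ od, act x m ∈ od
  act_o_ev : ∀ x ∈ L.odd, ∀ m ∈ ev, act x m ∈ od
  act_o_od : ∀ x ∈ L.odd, ∀ m ∈ od, act x m ∈ ev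
  act_br_e : ∀ x y : L.carrier, (x ∈ L.g0 ∨ y ∈ L.g0) → ∀ m,
    act (L.bracket x y) m = act x (act y m) - act y (act x m)
  act_br_oo : ∀ x ∈ L.odd, ∀ y ∈ L.odd, ∀ m,
    act (L.bracket x y) m = act x (act y m) + act y (act x m)

attribute [instance] SMod.isACG SMod.isMod

/-- A `𝔤₀̄`-supermodule: a `ℤ₂`-graded complex vector space with an action of the (purely
even) Lie algebra `𝔤₀̄ = 𝔤₀` preserving the grading. -/
structure SMod0 (L : GLSA) where
  carrier : Type
  [isACG : AddCommGroup carrier]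
  [isMod : Module ℂ carrier]
  act : ↥L.g0 →ₗ[ℂ] carrier →ₗ[ℂ] carrier
  ev : Submodule ℂ carrier
  od : Submodule ℂ carrier
  grading : IsCompl ev od
  act_ev : ∀ (x : L.g0), ∀ m ∈ ev, act x m ∈ ev
  act_od : ∀ (x : L.g0), ∀ m ∈ od, act x m ∈ od
  act_br : ∀ (x y : L.g0) (m : carrier),
    act ⟨L.bracket ↑x ↑y, L.br_00 ↑x x.2 ↑y y.2⟩ m = act x (act y m) - act y (act x m)

attribute [instance] SMod0.isACG SMod0.isMod

/-- A homomorphism of `𝔤`-supermodules (homogeneous of degree zero). -/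
structure SHom {L : GLSA} (M N : SMod L) where
  toLin : M.carrier →ₗ[ℂ] N.carrier
  map_ev : ∀ m ∈ M.ev, toLin m ∈ N.ev
  map_od : ∀ m ∈ M.od, toLin m ∈ N.od
  equivar : ∀ (x : L.carrier) (m : M.carrier), toLin (M.act x m) = N.act x (toLin m)

/-- Isomorphism of `𝔤`-supermodules. -/
def SIso {L : GLSA} (M N : SMod L) : Prop := ∃ f : SHom M N, Bijective f.toLin

/-- Isomorphism of `𝔤₀̄`-supermodules. -/
def SIso0 {L : GLSA} (V W : SMod0 L) : Prop :=
  ∃ e : V.carrier ≃ₗ[ℂ] W.carrier,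
    (∀ v ∈ V.ev, e v ∈ W.ev) ∧ (∀ v ∈ V.od, e v ∈ W.od) ∧
    (∀ (x : L.g0) (v : V.carrier), e (V.act x v) = W.act x (e v))

/-- Isomorphism of `𝔤`-supermodules up to parity change. -/
def SIsoUpToParity {L : GLSA} (M N : SMod L) : Prop :=
  ∃ e : M.carrier ≃ₗ[ℂ] N.carrier,
    (∀ (x : L.carrier) (m : M.carrier), e (M.act x m) = N.act x (e m)) ∧
    (((∀ m ∈ M.ev, e m ∈ N.ev) ∧ (∀ m ∈ M.od, e m ∈ N.od)) ∨
     ((∀ m ∈ M.ev, e m ∈ N.od) ∧ (∀ m ∈ M.od, e m ∈ N.ev)))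

namespace SMod

variable {L : GLSA}

/-- A (graded) sub-supermodule of a `𝔤`-supermodule. -/
def IsSubmod (M : SMod L) (N : Submodule ℂ M.carrier) : Prop :=
  (∀ (x : L.carrier), ∀ m ∈ N, M.act x m ∈ N) ∧ N ≤ (N ⊓ M.ev) ⊔ (N ⊓ M.od)

/-- A simple sub-supermodule. -/
def IsSimpleSub (M : SMod L) (N : Submodule ℂ M.carrier) : Prop :=
  M.IsSubmod N ∧ N ≠ ⊥ ∧ ∀ N', M.IsSubmod N' → N' ≤ N → N' = ⊥ ∨ N' = N

/-- The socle: the sum of all simple sub-supermodules. -/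
def socle (M : SMod L) : Submodule ℂ M.carrier := sSup {N | M.IsSimpleSub N}

/-- The sub-supermodule generated by a subspace, i.e. `U(𝔤)·S`. -/
def gen (M : SMod L) (S : Submodule ℂ M.carrier) : Submodule ℂ M.carrier :=
  sInf {N | M.IsSubmod N ∧ S ≤ N}

/-- Simplicity of a `𝔤`-supermodule. -/
def IsSimple (M : SMod L) : Prop :=
  (⊤ : Submodule ℂ M.carrier) ≠ ⊥ ∧ ∀ N, M.IsSubmod N → N = ⊥ ∨ N = ⊤

/-- Indecomposability of a `𝔤`-supermodule. -/
def Indecomposable (M : SMod L) : Prop :=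
  (⊤ : Submodule ℂ M.carrier) ≠ ⊥ ∧
  ∀ N₁ N₂, M.IsSubmod N₁ → M.IsSubmod N₂ → N₁ ⊓ N₂ = ⊥ → N₁ ⊔ N₂ = ⊤ →
    N₁ = ⊥ ∨ N₂ = ⊥

/-- The parity change functor `Π`. -/
def pshift (M : SMod L) : SMod L where
  carrier := M.carrier
  act := M.act
  ev := M.od
  od := M.ev
  grading := M.grading.symm
  act_e_ev := M.act_e_od
  act_e_od := M.act_e_ev
  act_o_ev := M.act_o_od
  act_o_od := M.act_o_ev
  act_br_e := M.act_br_e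
  act_br_oo := M.act_br_oo

/-- The space `M^{𝔤₁}` of `𝔤₁`-invariants. -/
def invPos (M : SMod L) : Submodule ℂ M.carrier where
  carrier := {m | ∀ x ∈ L.gpos, M.act x m = 0}
  add_mem' := by
    intro a b ha hb x hx
    rw [map_add, ha x hx, hb x hx, add_zero]
  zero_mem' := by intro x hx; simp
  smul_mem' := by
    intro c a ha x hx
    rw [map_smul, ha x hx, smul_zero]

/-- The space `M^{𝔤₋₁}` of `𝔤₋₁`-invariants. -/
def invNeg (M : SMod L) : Submodule ℂ M.carrier where
  carrier := {m | ∀ x ∈ L.gneg, M.act x m = 0}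
  add_mem' := by
    intro a b ha hb x hx
    rw [map_add, ha x hx, hb x hx, add_zero]
  zero_mem' := by intro x hx; simp
  smul_mem' := by
    intro c a ha x hx
    rw [map_smul, ha x hx, smul_zero]

/-- Iterated action of a list of elements of `𝔤`. -/
def actList (M : SMod L) : List L.carrier → M.carrier → M.carrier
  | [], m => m
  | x :: xs, m => M.act x (M.actList xs m)

end SMod

namespace SMod0

variable {L : GLSA}

/-- A (graded) sub-supermodule of a `𝔤₀̄`-supermodule. -/
def IsSubmod (V : SMod0 L) (N : Submodule ℂ V.carrier) : Prop :=
  (∀ (x : L.g0), ∀ v ∈ N, V.act x v ∈ N) ∧ N ≤ (N ⊓ V.ev) ⊔ (N ⊓ V.od)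

/-- Simplicity of a `𝔤₀̄`-supermodule. -/
def IsSimple (V : SMod0 L) : Prop :=
  (⊤ : Submodule ℂ V.carrier) ≠ ⊥ ∧ ∀ N, V.IsSubmod N → N = ⊥ ∨ N = ⊤

end SMod0

/-- `IsKac V K η` expresses that `K`, together with the (even, `𝔤₀̄`-equivariant) unit map
`η : V → K` whose image is annihilated by `𝔤₁`, is *the* Kac module
`K(V) = Ind_{𝔤≥0}^{𝔤} V` of the `𝔤₀̄`-supermodule `V` (on which `𝔤₁` acts by zero), i.e.
satisfies the universal property `Hom_𝔤(K(V), M) = Hom_{𝔤₀̄}(V, M^{𝔤₁})`. -/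
structure IsKac {L : GLSA} (V : SMod0 L) (K : SMod L) (η : V.carrier →ₗ[ℂ] K.carrier) : Prop where
  map_ev : ∀ v ∈ V.ev, η v ∈ K.ev
  map_od : ∀ v ∈ V.od, η v ∈ K.od
  equivar : ∀ (x : L.g0) (v : V.carrier), η (V.act x v) = K.act ↑x (η v)
  pos_zero : ∀ x ∈ L.gpos, ∀ v : V.carrier, K.act x (η v) = 0
  injective : Injective η
  generates : K.gen (LinearMap.range η) = ⊤
  universal : ∀ (M : SMod L) (φ : V.carrier →ₗ[ℂ] M.carrier),
    (∀ v ∈ V.ev, φ v ∈ M.ev) → (∀ v ∈ V.od, φ v ∈ M.od) →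
    (∀ (x : L.g0) (v : V.carrier), φ (V.act x v) = M.act ↑x (φ v)) →
    (∀ x ∈ L.gpos, ∀ v : V.carrier, M.act x (φ v) = 0) →
    ∃! Φ : SHom K M, ∀ v, Φ.toLin (η v) = φ v

/-- The opposite Kac module `K'(V) = Ind_{𝔤≤0}^{𝔤} V` (with `𝔤₋₁` acting by zero on `V`),
described by its universal property. -/
structure IsKac' {L : GLSA} (V : SMod0 L) (K : SMod L) (η : V.carrier →ₗ[ℂ] K.carrier) : Prop where
  map_ev : ∀ v ∈ V.ev, η v ∈ K.ev
  map_od : ∀ v ∈ V.od, η v ∈ K.od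
  equivar : ∀ (x : L.g0) (v : V.carrier), η (V.act x v) = K.act ↑x (η v)
  neg_zero : ∀ x ∈ L.gneg, ∀ v : V.carrier, K.act x (η v) = 0
  injective : Injective η
  generates : K.gen (LinearMap.range η) = ⊤
  universal : ∀ (M : SMod L) (φ : V.carrier →ₗ[ℂ] M.carrier),
    (∀ v ∈ V.ev, φ v ∈ M.ev) → (∀ v ∈ V.od, φ v ∈ M.od) →
    (∀ (x : L.g0) (v : V.carrier), φ (V.act x v) = M.act ↑x (φ v)) →
    (∀ x ∈ L.gneg, ∀ v : V.carrier, M.act x (φ v) = 0) →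
    ∃! Φ : SHom K M, ∀ v, Φ.toLin (η v) = φ v

/-- `IsCoindPos W C ε` expresses that `C`, together with the (even, `𝔤₀̄`-equivariant)
counit `ε : C → W` killing `𝔤₁·C`, is the coinduced module `Coind_{𝔤≥0}^{𝔤}(W)` of the
`𝔤₀̄`-supermodule `W` (with `𝔤₁` acting by zero), i.e. satisfies the universal property
`Hom_𝔤(M, Coind(W)) = Hom_{𝔤≥0}(Res M, W)`. -/
structure IsCoindPos {L : GLSA} (W : SMod0 L) (C : SMod L) (ε : C.carrier →ₗ[ℂ] W.carrier) : Prop where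
  map_ev : ∀ c ∈ C.ev, ε c ∈ W.ev
  map_od : ∀ c ∈ C.od, ε c ∈ W.od
  equivar : ∀ (x : L.g0) (c : C.carrier), ε (C.act ↑x c) = W.act x (ε c)
  pos_zero : ∀ x ∈ L.gpos, ∀ c : C.carrier, ε (C.act x c) = 0
  universal : ∀ (M : SMod L) (ψ : M.carrier →ₗ[ℂ] W.carrier),
    (∀ m ∈ M.ev, ψ m ∈ W.ev) → (∀ m ∈ M.od, ψ m ∈ W.od) →
    (∀ (x : L.g0) (m : M.carrier), ψ (M.act ↑x m) = W.act x (ψ m)) →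
    (∀ x ∈ L.gpos, ∀ m : M.carrier, ψ (M.act x m) = 0) →
    ∃! Φ : SHom M C, ∀ m, ε (Φ.toLin m) = ψ m

/-- `Coind_{𝔤≤0}^{𝔤}(W)`, by its universal property. -/
structure IsCoindNeg {L : GLSA} (W : SMod0 L) (C : SMod L) (ε : C.carrier →ₗ[ℂ] W.carrier) : Prop where
  map_ev : ∀ c ∈ C.ev, ε c ∈ W.ev
  map_od : ∀ c ∈ C.od, ε c ∈ W.od
  equivar : ∀ (x : L.g0) (c : C.carrier), ε (C.act ↑x c) = W.act x (ε c)
  neg_zero : ∀ x ∈ L.gneg, ∀ c : C.carrier, ε (C.act x c) = 0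
  universal : ∀ (M : SMod L) (ψ : M.carrier →ₗ[ℂ] W.carrier),
    (∀ m ∈ M.ev, ψ m ∈ W.ev) → (∀ m ∈ M.od, ψ m ∈ W.od) →
    (∀ (x : L.g0) (m : M.carrier), ψ (M.act ↑x m) = W.act x (ψ m)) →
    (∀ x ∈ L.gneg, ∀ m : M.carrier, ψ (M.act x m) = 0) →
    ∃! Φ : SHom M C, ∀ m, ε (Φ.toLin m) = ψ m

/-- The subspace `Λ^max(𝔤₋₁) ⊗ V ⊆ K(V)`: the span of all elements obtained by acting on
`η(V)` with `dim 𝔤₋₁` many elements of `𝔤₋₁`. -/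
def botPartNeg {L : GLSA} (V : SMod0 L) (K : SMod L) (η : V.carrier →ₗ[ℂ] K.carrier) :
    Submodule ℂ K.carrier :=
  Submodule.span ℂ {m | ∃ (xs : List L.carrier) (v : V.carrier),
    xs.length = finrank ℂ ↥L.gneg ∧ (∀ x ∈ xs, x ∈ L.gneg) ∧ m = K.actList xs (η v)}

/-- The subspace `Λ^max(𝔤₁) ⊗ V ⊆ K'(V)`. -/
def botPartPos {L : GLSA} (V : SMod0 L) (K : SMod L) (η : V.carrier →ₗ[ℂ] K.carrier) :
    Submodule ℂ K.carrier :=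
  Submodule.span ℂ {m | ∃ (xs : List L.carrier) (v : V.carrier),
    xs.length = finrank ℂ ↥L.gpos ∧ (∀ x ∈ xs, x ∈ L.gpos) ∧ m = K.actList xs (η v)}

/-- For `x ∈ 𝔤₀̄`, the operator `ad x` restricted to `𝔤₁`. -/
def adPos (L : GLSA) (x : L.g0) : ↥L.gpos →ₗ[ℂ] ↥L.gpos :=
  (L.bracket ↑x).restrict (fun y hy => L.br_0p ↑x x.2 y hy)

/-- For `x ∈ 𝔤₀̄`, the operator `ad x` restricted to `𝔤₋₁`. -/
def adNeg (L : GLSA) (x : L.g0) : ↥L.gneg →ₗ[ℂ] ↥L.gneg :=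
  (L.bracket ↑x).restrict (fun y hy => L.br_0n ↑x x.2 y hy)

/-- The character by which `𝔤₀̄` acts on the one-dimensional module `Λ^max(𝔤₁)`. -/
def traceCharPos (L : GLSA) (x : L.g0) : ℂ := LinearMap.trace ℂ ↥L.gpos (adPos L x)

/-- The character by which `𝔤₀̄` acts on the one-dimensional module `Λ^max(𝔤₋₁)`. -/
def traceCharNeg (L : GLSA) (x : L.g0) : ℂ := LinearMap.trace ℂ ↥L.gneg (adNeg L x)

/-- `IsTwistBy V W χ swap` expresses that `W ≅ ℂ_χ ⊗ V` as `𝔤₀̄`-supermodules, where `ℂ_χ`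
is the one-dimensional module with character `χ`, of odd parity iff `swap = true`.
Taking `χ` to be `traceCharPos`/`traceCharNeg` (resp. their negatives) and `swap` the parity
of `dim 𝔤±₁` expresses `W ≅ Λ^max(𝔤±₁) ⊗ V` (resp. `W ≅ Λ^max(𝔤±₁^*) ⊗ V`). -/
def IsTwistBy {L : GLSA} (V W : SMod0 L) (χ : ↥L.g0 → ℂ) (swap : Bool) : Prop :=
  ∃ e : V.carrier ≃ₗ[ℂ] W.carrier,
    (∀ (x : L.g0) (v : V.carrier), W.act x (e v) = e (V.act x v) + χ x • e v) ∧
    (if swap then (∀ v ∈ V.ev, e v ∈ W.od) ∧ (∀ v ∈ V.od, e v ∈ W.ev)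
     else (∀ v ∈ V.ev, e v ∈ W.ev) ∧ (∀ v ∈ V.od, e v ∈ W.od))

/-- Parity (as a `Bool`) of `dim 𝔤₁`. -/
def parPos (L : GLSA) : Bool := (finrank ℂ ↥L.gpos) % 2 == 1

/-- Parity (as a `Bool`) of `dim 𝔤₋₁`. -/
def parNeg (L : GLSA) : Bool := (finrank ℂ ↥L.gneg) % 2 == 1


section Involutions

variable {V : Type*} [AddCommGroup V] [Module ℂ V]

lemma eq_zero_of_eq_neg_self {v : V} (h : v = -v) : v = 0 := by
  have h₂ : (2 : ℂ) • v = 0 := by rw [two_smul, ← eq_neg_iff_add_eq_zero]; exact h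
  simpa using h₂

lemma mem_ker_sub_id (σ : V →ₗ[ℂ] V) (m : V) :
    m ∈ LinearMap.ker (σ - LinearMap.id) ↔ σ m = m := by
  rw [LinearMap.mem_ker, LinearMap.sub_apply, LinearMap.id_apply, sub_eq_zero]

lemma mem_ker_add_id (σ : V →ₗ[ℂ] V) (m : V) :
    m ∈ LinearMap.ker (σ + LinearMap.id) ↔ σ m = -m := by
  rw [LinearMap.mem_ker, LinearMap.add_apply, LinearMap.id_apply, add_eq_zero_iff_eq_neg]

/-- A decomposition `V = ev ⊕ od` is the eigenspace decomposition of a parity involution. -/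
lemma exists_parity {ev od : Submodule ℂ V} (h : IsCompl ev od) :
    ∃ σ : V →ₗ[ℂ] V, (∀ m, σ (σ m) = m) ∧ (∀ m, m ∈ ev ↔ σ m = m) ∧
      (∀ m, m ∈ od ↔ σ m = -m) := by
  let σ : V →ₗ[ℂ] V := LinearMap.ofIsCompl h ev.subtype (-od.subtype)
  have he : ∀ m ∈ ev, σ m = m := fun m hm =>
    LinearMap.ofIsCompl_apply_left h (φ := ev.subtype) (ψ := -od.subtype) ⟨m, hm⟩
  have ho : ∀ m ∈ od, σ m = -m := fun m hm =>
    LinearMap.ofIsCompl_apply_right h (φ := ev.subtype) (ψ := -od.subtype) ⟨m, hm⟩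
  have hsum : ∀ m, ∃ a ∈ ev, ∃ b ∈ od, a + b = m := fun m =>
    Submodule.mem_sup.1 (h.sup_eq_top ▸ Submodule.mem_top)
  refine ⟨σ, fun m => ?_, fun m => ⟨he m, fun hm => ?_⟩, fun m => ⟨ho m, fun hm => ?_⟩⟩
  · obtain ⟨a, ha, b, hb, rfl⟩ := hsum m
    simp [he a ha, ho b hb]
  · obtain ⟨a, ha, b, hb, rfl⟩ := hsum m
    rw [map_add, he a ha, ho b hb, add_right_inj] at hm
    simpa [eq_zero_of_eq_neg_self hm.symm] using ha
  · obtain ⟨a, ha, b, hb, rfl⟩ := hsum m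
    rw [map_add, he a ha, ho b hb, neg_add, add_left_inj] at hm
    simpa [eq_zero_of_eq_neg_self hm] using hb

lemma isCompl_ker_sub_ker_add {σ : V →ₗ[ℂ] V} (h : ∀ m, σ (σ m) = m) :
    IsCompl (LinearMap.ker (σ - LinearMap.id)) (LinearMap.ker (σ + LinearMap.id)) := by
  refine IsCompl.of_eq ?_ ?_
  · rw [eq_bot_iff]
    rintro m ⟨h₁, h₂⟩
    exact eq_zero_of_eq_neg_self
      (((mem_ker_sub_id σ m).1 h₁).symm.trans ((mem_ker_add_id σ m).1 h₂))
  · rw [eq_top_iff]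
    intro m _
    refine Submodule.mem_sup.2 ⟨(1 / 2 : ℂ) • (m + σ m), ?_, (1 / 2 : ℂ) • (m - σ m), ?_, ?_⟩
    · simp [h, add_comm]
    · simp [h]
    · rw [← smul_add, add_add_sub_cancel, ← two_smul ℂ m, smul_smul]
      norm_num

lemma le_inf_sup_inf {ev od : Submodule ℂ V} {σ : V →ₗ[ℂ] V} (hσ : ∀ m, σ (σ m) = m)
    (hev : ∀ m, m ∈ ev ↔ σ m = m) (hod : ∀ m, m ∈ od ↔ σ m = -m)
    {N : Submodule ℂ V} (hN : ∀ m ∈ N, σ m ∈ N) : N ≤ (N ⊓ ev) ⊔ (N ⊓ od) := by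
  intro m hm
  refine Submodule.mem_sup.2 ⟨(1 / 2 : ℂ) • (m + σ m),
    ⟨N.smul_mem _ (N.add_mem hm (hN m hm)), (hev _).2 ?_⟩, (1 / 2 : ℂ) • (m - σ m),
    ⟨N.smul_mem _ (N.sub_mem hm (hN m hm)), (hod _).2 ?_⟩, ?_⟩
  · simp [hσ, add_comm]
  · rw [map_smul, map_sub, hσ, ← smul_neg, neg_sub]
  · rw [← smul_add, add_add_sub_cancel, ← two_smul ℂ m, smul_smul]
    norm_num

lemma parity_mem_of_le {ev od : Submodule ℂ V} {σ : V →ₗ[ℂ] V}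
    (hev : ∀ m, m ∈ ev ↔ σ m = m) (hod : ∀ m, m ∈ od ↔ σ m = -m)
    {N : Submodule ℂ V} (hN : N ≤ (N ⊓ ev) ⊔ (N ⊓ od)) (m : V) (hm : m ∈ N) : σ m ∈ N := by
  obtain ⟨a, ⟨ha, ha'⟩, b, ⟨hb, hb'⟩, rfl⟩ := Submodule.mem_sup.1 (hN hm)
  rw [map_add, (hev a).1 ha', (hod b).1 hb']
  exact N.add_mem ha (N.neg_mem hb)

end Involutions

section Operators

variable {V : Type*} [AddCommGroup V] [Module ℂ V]

/-- Finitely many pairwise anticommuting operators of square zero on a nonzero space have a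
common nonzero left annihilator. -/
lemma exists_ne_zero_comp_eq_zero [Nontrivial V] (s : Finset (V →ₗ[ℂ] V))
    (hs : ∀ a ∈ s, ∀ b ∈ s, ∀ v, a (b v) = -b (a v)) :
    ∃ p : V →ₗ[ℂ] V, p ≠ 0 ∧ ∀ a ∈ s, ∀ v, p (a v) = 0 := by
  classical
  induction s using Finset.induction_on with
  | empty => exact ⟨LinearMap.id, one_ne_zero (α := Module.End ℂ V), by simp⟩
  | insert x s _ ih =>
    obtain ⟨p, hp, hps⟩ := ih fun a ha b hb =>
      hs a (Finset.mem_insert_of_mem ha) b (Finset.mem_insert_of_mem hb)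
    by_cases hx : p ∘ₗ x = 0
    · refine ⟨p, hp, fun a ha v => ?_⟩
      rcases Finset.mem_insert.1 ha with rfl | ha
      · exact LinearMap.congr_fun hx v
      · exact hps a ha v
    · refine ⟨p ∘ₗ x, hx, fun a ha v => ?_⟩
      rcases Finset.mem_insert.1 ha with rfl | ha'
      · have := eq_zero_of_eq_neg_self (hs a ha a ha v)
        simp [this]
      · simp [hs x (Finset.mem_insert_self x s) a ha v, hps a ha']

/-- Under finitely many pairwise anticommuting operators of square zero, a finite-dimensional
subspace generates a finite-dimensional stable subspace. -/
lemma exists_fg_stable (s : Finset (V →ₗ[ℂ] V))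
    (hs : ∀ a ∈ s, ∀ b ∈ s, ∀ v, a (b v) = -b (a v)) (T₀ : Submodule ℂ V) (hT₀ : T₀.FG) :
    ∃ T : Submodule ℂ V, T.FG ∧ T₀ ≤ T ∧ (∀ a ∈ s, ∀ t ∈ T, a t ∈ T) ∧
      ∀ Q : Submodule ℂ V, T₀ ≤ Q → (∀ a ∈ s, ∀ q ∈ Q, a q ∈ Q) → T ≤ Q := by
  classical
  induction s using Finset.induction_on with
  | empty => exact ⟨T₀, hT₀, le_rfl, by simp, fun Q hQ _ => hQ⟩
  | insert x s _ ih =>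
    obtain ⟨T, hT, hle, hst, hmin⟩ := ih fun a ha b hb =>
      hs a (Finset.mem_insert_of_mem ha) b (Finset.mem_insert_of_mem hb)
    refine ⟨T ⊔ T.map x, hT.sup (hT.map x), hle.trans le_sup_left, fun a ha t ht => ?_,
      fun Q hQ hQs => ?_⟩
    · obtain ⟨t₁, ht₁, _, ⟨t₂, ht₂, rfl⟩, rfl⟩ := Submodule.mem_sup.1 ht
      rw [map_add]
      rcases Finset.mem_insert.1 ha with rfl | ha'
      · rw [eq_zero_of_eq_neg_self (hs a ha a ha t₂), add_zero]
        exact Submodule.mem_sup_right ⟨t₁, ht₁, rfl⟩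
      · rw [hs a ha x (Finset.mem_insert_self x s)]
        exact add_mem (Submodule.mem_sup_left (hst a ha' t₁ ht₁))
          (neg_mem (Submodule.mem_sup_right ⟨a t₂, hst a ha' t₂ ht₂, rfl⟩))
    · have hTQ := hmin Q hQ fun a ha => hQs a (Finset.mem_insert_of_mem ha)
      refine sup_le hTQ ?_
      rintro _ ⟨t, ht, rfl⟩
      exact hQs x (Finset.mem_insert_self x s) t (hTQ ht)

/-- If a space is generated by a finite-dimensional subspace under a set of operators, then
every proper stable subspace is contained in a maximal one. -/
lemma exists_maximal_stable (E : Set (V →ₗ[ℂ] V)) {T : Submodule ℂ V} (hT : T.FG)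
    (hgen : ∀ Q : Submodule ℂ V, (∀ a ∈ E, ∀ q ∈ Q, a q ∈ Q) → T ≤ Q → Q = ⊤)
    {G : Submodule ℂ V} (hG : ∀ a ∈ E, ∀ q ∈ G, a q ∈ G) (hG' : G ≠ ⊤) :
    ∃ P : Submodule ℂ V, (∀ a ∈ E, ∀ q ∈ P, a q ∈ P) ∧ G ≤ P ∧ P ≠ ⊤ ∧
      ∀ Q : Submodule ℂ V, (∀ a ∈ E, ∀ q ∈ Q, a q ∈ Q) → P ≤ Q → Q = P ∨ Q = ⊤ := by
  obtain ⟨P, hGP, hP⟩ := zorn_le_nonempty₀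
    {Q : Submodule ℂ V | (∀ a ∈ E, ∀ q ∈ Q, a q ∈ Q) ∧ Q ≠ ⊤} (fun c hc hchain Q₀ hQ₀ => by
      have hdir : DirectedOn (· ≤ ·) c := hchain.directedOn
      refine ⟨sSup c, ⟨fun a ha q hq => ?_, fun htop => ?_⟩, fun Q hQ => le_sSup hQ⟩
      · obtain ⟨Q, hQ, hqQ⟩ := (Submodule.mem_sSup_of_directed ⟨Q₀, hQ₀⟩ hdir).1 hq
        exact (le_sSup hQ : Q ≤ sSup c) ((hc hQ).1 a ha q hqQ)
      · have hc' := (Submodule.fg_iff_compact T).1 hT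
        rw [CompleteLattice.isCompactElement_iff_le_of_directed_sSup_le] at hc'
        obtain ⟨Q, hQ, hTQ⟩ := hc' c ⟨Q₀, hQ₀⟩ hdir (htop ▸ le_top)
        exact (hc hQ).2 (hgen Q (hc hQ).1 hTQ)) G ⟨hG, hG'⟩
  refine ⟨P, hP.prop.1, hGP, hP.prop.2, fun Q hQ hPQ => ?_⟩
  by_cases hQt : Q = ⊤
  · exact Or.inr hQt
  · exact Or.inl (le_antisymm (hP.le_of_ge ⟨hQ, hQt⟩ hPQ) hPQ)

end Operators

section Parity

variable {L : GLSA}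

lemma GLSA.bracket_odd_odd {x y : L.carrier} (hx : x ∈ L.odd) (hy : y ∈ L.odd) :
    L.bracket x y ∈ L.g0 := by
  obtain ⟨a, ha, b, hb, rfl⟩ := Submodule.mem_sup.1 hx
  obtain ⟨c, hc, d, hd, rfl⟩ := Submodule.mem_sup.1 hy
  simp only [map_add, LinearMap.add_apply, L.br_nn a ha c hc, L.br_pp b hb d hd, add_zero,
    zero_add]
  rw [L.skew_oo a (Submodule.mem_sup_left ha) d (Submodule.mem_sup_right hd)]
  exact add_mem (L.br_pn b hb c hc) (L.br_pn d hd a ha)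

lemma GLSA.bracket_g0_odd {x y : L.carrier} (hx : x ∈ L.g0) (hy : y ∈ L.odd) :
    L.bracket x y ∈ L.odd := by
  obtain ⟨c, hc, d, hd, rfl⟩ := Submodule.mem_sup.1 hy
  rw [map_add]
  exact add_mem (Submodule.mem_sup_left (L.br_0n x hx c hc))
    (Submodule.mem_sup_right (L.br_0p x hx d hd))

lemma GLSA.exists_add (x : L.carrier) : ∃ a ∈ L.g0, ∃ b ∈ L.odd, a + b = x :=
  Submodule.mem_sup.1 (L.oddCompl.sup_eq_top ▸ Submodule.mem_top)

/-- A parity involution of the Lie superalgebra `L`. -/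
structure GLSA.Parity (L : GLSA) where
  σ : L.carrier →ₗ[ℂ] L.carrier
  invol : ∀ x, σ (σ x) = x
  mem_g0 : ∀ x, x ∈ L.g0 ↔ σ x = x
  mem_odd : ∀ x, x ∈ L.odd ↔ σ x = -x

/-- The parity involution of `L`. -/
def GLSA.parity (L : GLSA) : L.Parity where
  σ := (exists_parity L.oddCompl).choose
  invol := (exists_parity L.oddCompl).choose_spec.1
  mem_g0 := (exists_parity L.oddCompl).choose_spec.2.1
  mem_odd := (exists_parity L.oddCompl).choose_spec.2.2

lemma GLSA.parity_g0 {x : L.carrier} (hx : x ∈ L.g0) : L.parity.σ x = x :=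
  (L.parity.mem_g0 x).1 hx

lemma GLSA.parity_odd {x : L.carrier} (hx : x ∈ L.odd) : L.parity.σ x = -x :=
  (L.parity.mem_odd x).1 hx

lemma GLSA.parity_bracket (x y : L.carrier) :
    L.parity.σ (L.bracket x y) = L.bracket (L.parity.σ x) (L.parity.σ y) := by
  obtain ⟨a, ha, b, hb, rfl⟩ := L.exists_add x
  obtain ⟨c, hc, d, hd, rfl⟩ := L.exists_add y
  have hbc : L.bracket b c ∈ L.odd := by
    rw [← neg_neg (L.bracket b c), ← L.skew_e c hc b]
    exact neg_mem (GLSA.bracket_g0_odd hc hb)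
  simp only [map_add, LinearMap.add_apply, GLSA.parity_g0 ha, GLSA.parity_g0 hc,
    GLSA.parity_odd hb, GLSA.parity_odd hd, GLSA.parity_g0 (L.br_00 a ha c hc),
    GLSA.parity_odd (GLSA.bracket_g0_odd ha hd), GLSA.parity_odd hbc,
    GLSA.parity_g0 (GLSA.bracket_odd_odd hb hd), map_neg, LinearMap.neg_apply, neg_neg, neg_add]

lemma SMod.parity_act (M : SMod L) {τ : M.carrier →ₗ[ℂ] M.carrier}
    (hev : ∀ m, m ∈ M.ev ↔ τ m = m) (hod : ∀ m, m ∈ M.od ↔ τ m = -m)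
    (x : L.carrier) (m : M.carrier) : τ (M.act x m) = M.act (L.parity.σ x) (τ m) := by
  obtain ⟨a, ha, b, hb, rfl⟩ := L.exists_add x
  obtain ⟨c, hc, d, hd, rfl⟩ : ∃ c ∈ M.ev, ∃ d ∈ M.od, c + d = m :=
    Submodule.mem_sup.1 (M.grading.sup_eq_top ▸ Submodule.mem_top)
  simp only [map_add, LinearMap.add_apply, GLSA.parity_g0 ha, GLSA.parity_odd hb,
    (hev c).1 hc, (hod d).1 hd, (hev _).1 (M.act_e_ev a ha c hc),
    (hod _).1 (M.act_e_od a ha d hd), (hod _).1 (M.act_o_ev b hb c hc),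
    (hev _).1 (M.act_o_od b hb d hd), map_neg, LinearMap.neg_apply, neg_neg, neg_add]

lemma SMod0.parity_act (W : SMod0 L) {τ : W.carrier →ₗ[ℂ] W.carrier}
    (hev : ∀ m, m ∈ W.ev ↔ τ m = m) (hod : ∀ m, m ∈ W.od ↔ τ m = -m)
    (x : L.g0) (m : W.carrier) : τ (W.act x m) = W.act x (τ m) := by
  obtain ⟨c, hc, d, hd, rfl⟩ : ∃ c ∈ W.ev, ∃ d ∈ W.od, c + d = m :=
    Submodule.mem_sup.1 (W.grading.sup_eq_top ▸ Submodule.mem_top)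
  simp only [map_add, (hev c).1 hc, (hod d).1 hd, (hev _).1 (W.act_ev x c hc),
    (hod _).1 (W.act_od x d hd), map_neg]

end Parity

section Coinduced

variable {L : GLSA}

lemma SMod.actList_append (M : SMod L) (l₁ l₂ : List L.carrier) (m : M.carrier) :
    M.actList (l₁ ++ l₂) m = M.actList l₁ (M.actList l₂ m) := by
  induction l₁ with
  | nil => rfl
  | cons x l ih => simp only [List.cons_append, SMod.actList, ih]

/-- Iterated action as a linear map. -/
def SMod.actListLin (M : SMod L) : List L.carrier → M.carrier →ₗ[ℂ] M.carrier
  | [] => LinearMap.id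
  | x :: xs => M.act x ∘ₗ M.actListLin xs

lemma SMod.actListLin_apply (M : SMod L) (l : List L.carrier) (m : M.carrier) :
    M.actListLin l m = M.actList l m := by
  induction l with
  | nil => rfl
  | cons x l ih => simp only [SMod.actListLin, SMod.actList, LinearMap.comp_apply, ih]

/-- The functions on words in `L` which factor through a `𝔤≥0`-equivariant linear map from the
universal enveloping superalgebra of `L` to `W`. -/
structure IsCoindFun (W : SMod0 L) (f : List L.carrier → W.carrier) : Prop where
  add : ∀ l₁ l₂ x y, f (l₁ ++ (x + y) :: l₂) = f (l₁ ++ x :: l₂) + f (l₁ ++ y :: l₂)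
  smul : ∀ l₁ l₂ (c : ℂ) x, f (l₁ ++ (c • x) :: l₂) = c • f (l₁ ++ x :: l₂)
  br_e : ∀ l₁ l₂ x y, (x ∈ L.g0 ∨ y ∈ L.g0) →
    f (l₁ ++ L.bracket x y :: l₂) = f (l₁ ++ x :: y :: l₂) - f (l₁ ++ y :: x :: l₂)
  br_oo : ∀ l₁ l₂, ∀ x ∈ L.odd, ∀ y ∈ L.odd,
    f (l₁ ++ L.bracket x y :: l₂) = f (l₁ ++ x :: y :: l₂) + f (l₁ ++ y :: x :: l₂)
  equivar : ∀ (x : L.g0) l, f (x :: l) = W.act x (f l)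
  pos_zero : ∀ x ∈ L.gpos, ∀ l, f (x :: l) = 0

/-- The space underlying the coinduced module. -/
def coindSpace (W : SMod0 L) : Submodule ℂ (List L.carrier → W.carrier) where
  carrier := {f | IsCoindFun W f}
  add_mem' {f g} hf hg := by
    refine ⟨fun l₁ l₂ x y => ?_, fun l₁ l₂ c x => ?_, fun l₁ l₂ x y h => ?_,
      fun l₁ l₂ x hx y hy => ?_, fun x l => ?_, fun x hx l => ?_⟩
    · simp only [Pi.add_apply, hf.add, hg.add]; abel
    · simp only [Pi.add_apply, hf.smul, hg.smul, smul_add]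
    · simp only [Pi.add_apply, hf.br_e _ _ x y h, hg.br_e _ _ x y h]; abel
    · simp only [Pi.add_apply, hf.br_oo _ _ x hx y hy, hg.br_oo _ _ x hx y hy]; abel
    · simp only [Pi.add_apply, hf.equivar, hg.equivar, map_add]
    · simp only [Pi.add_apply, hf.pos_zero x hx, hg.pos_zero x hx, add_zero]
  zero_mem' := by constructor <;> simp
  smul_mem' c f hf := by
    refine ⟨fun l₁ l₂ x y => ?_, fun l₁ l₂ d x => ?_, fun l₁ l₂ x y h => ?_,
      fun l₁ l₂ x hx y hy => ?_, fun x l => ?_, fun x hx l => ?_⟩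
    · simp only [Pi.smul_apply, hf.add, smul_add]
    · simp only [Pi.smul_apply, hf.smul, smul_comm c d]
    · simp only [Pi.smul_apply, hf.br_e _ _ x y h, smul_sub]
    · simp only [Pi.smul_apply, hf.br_oo _ _ x hx y hy, smul_add]
    · simp only [Pi.smul_apply, hf.equivar, map_smul]
    · simp only [Pi.smul_apply, hf.pos_zero x hx, smul_zero]

lemma IsCoindFun.append {W : SMod0 L} {f : List L.carrier → W.carrier} (hf : IsCoindFun W f)
    (r : List L.carrier) : IsCoindFun W fun l => f (l ++ r) := by
  refine ⟨fun l₁ l₂ x y => ?_, fun l₁ l₂ c x => ?_, fun l₁ l₂ x y h => ?_,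
    fun l₁ l₂ x hx y hy => ?_, fun x l => ?_, fun x hx l => ?_⟩ <;>
    simp only [List.append_assoc, List.cons_append]
  · exact hf.add _ _ x y
  · exact hf.smul _ _ c x
  · exact hf.br_e _ _ x y h
  · exact hf.br_oo _ _ x hx y hy
  · exact hf.equivar x _
  · exact hf.pos_zero x hx _

lemma IsCoindFun.parity {W : SMod0 L} {f : List L.carrier → W.carrier} (hf : IsCoindFun W f)
    {τ : W.carrier →ₗ[ℂ] W.carrier} (hτ : ∀ (x : L.g0) w, τ (W.act x w) = W.act x (τ w)) :
    IsCoindFun W fun l => τ (f (l.map L.parity.σ)) := by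
  refine ⟨fun l₁ l₂ x y => ?_, fun l₁ l₂ c x => ?_, fun l₁ l₂ x y h => ?_,
    fun l₁ l₂ x hx y hy => ?_, fun x l => ?_, fun x hx l => ?_⟩ <;>
    simp only [List.map_append, List.map_cons, map_add, map_smul, GLSA.parity_bracket]
  · rw [hf.add, map_add]
  · rw [hf.smul, map_smul]
  · rw [hf.br_e, map_sub]
    exact h.imp (fun h => by rwa [GLSA.parity_g0 h]) (fun h => by rwa [GLSA.parity_g0 h])
  · rw [hf.br_oo, map_add]
    · rw [GLSA.parity_odd hx]; exact neg_mem hx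
    · rw [GLSA.parity_odd hy]; exact neg_mem hy
  · rw [GLSA.parity_g0 x.2, hf.equivar, hτ]
  · rw [GLSA.parity_odd (Submodule.mem_sup_right hx), hf.pos_zero _ (neg_mem hx), map_zero]

/-- The action on the coinduced module, by right translation of words. -/
def coindAct (W : SMod0 L) :
    L.carrier →ₗ[ℂ] ↥(coindSpace W) →ₗ[ℂ] ↥(coindSpace W) :=
  LinearMap.mk₂ ℂ (fun x f => ⟨fun l => f.1 (l ++ [x]), IsCoindFun.append f.2 [x]⟩)
    (fun x y f => Subtype.ext <| funext fun l => f.2.add l [] x y)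
    (fun c x f => Subtype.ext <| funext fun l => f.2.smul l [] c x)
    (fun _ _ _ => rfl) (fun _ _ _ => rfl)

lemma coindAct_apply (W : SMod0 L) (x : L.carrier) (f : coindSpace W) (l : List L.carrier) :
    (coindAct W x f).1 l = f.1 (l ++ [x]) := rfl

/-- The parity involution of the coinduced module. -/
def coindParity (W : SMod0 L) (τ : W.carrier →ₗ[ℂ] W.carrier)
    (hτ : ∀ (x : L.g0) w, τ (W.act x w) = W.act x (τ w)) :
    ↥(coindSpace W) →ₗ[ℂ] ↥(coindSpace W) where
  toFun f := ⟨fun l => τ (f.1 (l.map L.parity.σ)), IsCoindFun.parity f.2 hτ⟩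
  map_add' _ _ := Subtype.ext <| funext fun _ => map_add τ _ _
  map_smul' _ _ := Subtype.ext <| funext fun _ => map_smul τ _ _

lemma coindParity_apply (W : SMod0 L) (τ : W.carrier →ₗ[ℂ] W.carrier)
    (hτ : ∀ (x : L.g0) w, τ (W.act x w) = W.act x (τ w)) (f : coindSpace W)
    (l : List L.carrier) : (coindParity W τ hτ f).1 l = τ (f.1 (l.map L.parity.σ)) := rfl

lemma coindParity_act (W : SMod0 L) (τ : W.carrier →ₗ[ℂ] W.carrier)
    (hτ : ∀ (x : L.g0) w, τ (W.act x w) = W.act x (τ w)) (x : L.carrier) (f : coindSpace W) :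
    coindParity W τ hτ (coindAct W x f) =
      coindAct W (L.parity.σ x) (coindParity W τ hτ f) := by
  ext l
  simp only [coindParity_apply, coindAct_apply, List.map_append, List.map_cons, List.map_nil,
    L.parity.invol]

/-- The coinduced module `Coind_{𝔤≥0}^{𝔤}(W)`. -/
def coind (W : SMod0 L) (τ : W.carrier →ₗ[ℂ] W.carrier) (hinv : ∀ w, τ (τ w) = w)
    (hτ : ∀ (x : L.g0) w, τ (W.act x w) = W.act x (τ w)) : SMod L where
  carrier := coindSpace W
  act := coindAct W
  ev := LinearMap.ker (coindParity W τ hτ - LinearMap.id)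
  od := LinearMap.ker (coindParity W τ hτ + LinearMap.id)
  grading := isCompl_ker_sub_ker_add fun f => by
    ext l
    simp only [coindParity_apply, hinv, List.map_map]
    simp [Function.comp_def, L.parity.invol]
  act_e_ev x hx f hf := (mem_ker_sub_id _ _).2 <| by
    rw [coindParity_act, (mem_ker_sub_id _ f).1 hf, GLSA.parity_g0 hx]
  act_e_od x hx f hf := (mem_ker_add_id _ _).2 <| by
    rw [coindParity_act, (mem_ker_add_id _ f).1 hf, GLSA.parity_g0 hx, map_neg]
  act_o_ev x hx f hf := (mem_ker_add_id _ _).2 <| by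
    rw [coindParity_act, (mem_ker_sub_id _ f).1 hf, GLSA.parity_odd hx, map_neg,
      LinearMap.neg_apply]
  act_o_od x hx f hf := (mem_ker_sub_id _ _).2 <| by
    rw [coindParity_act, (mem_ker_add_id _ f).1 hf, GLSA.parity_odd hx, map_neg, map_neg,
      LinearMap.neg_apply, neg_neg]
  act_br_e x y h f := Subtype.ext <| funext fun l => by
    simpa [coindAct_apply] using f.2.br_e l [] x y h
  act_br_oo x hx y hy f := Subtype.ext <| funext fun l => by
    simpa [coindAct_apply] using f.2.br_oo l [] x hx y hy

lemma isCoindFun_actList (W : SMod0 L) (M : SMod L) (ψ : M.carrier →ₗ[ℂ] W.carrier)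
    (h0 : ∀ (x : L.g0) (m : M.carrier), ψ (M.act ↑x m) = W.act x (ψ m))
    (hp : ∀ x ∈ L.gpos, ∀ m : M.carrier, ψ (M.act x m) = 0) (m : M.carrier) :
    IsCoindFun W fun l => ψ (M.actListLin l m) := by
  refine ⟨fun l₁ l₂ x y => ?_, fun l₁ l₂ c x => ?_, fun l₁ l₂ x y h => ?_,
    fun l₁ l₂ x hx y hy => ?_, fun x l => h0 x _, fun x hx l => hp x hx _⟩ <;>
    simp only [SMod.actListLin_apply, SMod.actList_append, SMod.actList] <;>
    simp only [← SMod.actListLin_apply]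
  · simp only [map_add, LinearMap.add_apply]
  · simp only [map_smul, LinearMap.smul_apply]
  · simp only [M.act_br_e x y h, map_sub]
  · simp only [M.act_br_oo x hx y hy, map_add]

/-- The map to the coinduced module determined by a `𝔤≥0`-equivariant map. -/
def toCoind (W : SMod0 L) (M : SMod L) (ψ : M.carrier →ₗ[ℂ] W.carrier)
    (h0 : ∀ (x : L.g0) (m : M.carrier), ψ (M.act ↑x m) = W.act x (ψ m))
    (hp : ∀ x ∈ L.gpos, ∀ m : M.carrier, ψ (M.act x m) = 0) :
    M.carrier →ₗ[ℂ] ↥(coindSpace W) where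
  toFun m := ⟨fun l => ψ (M.actListLin l m), isCoindFun_actList W M ψ h0 hp m⟩
  map_add' m n := Subtype.ext <| funext fun l => by simp
  map_smul' c m := Subtype.ext <| funext fun l => by simp

/-- Coinduced modules exist. -/
lemma exists_isCoindPos (W : SMod0 L) :
    ∃ (C : SMod L) (ε : C.carrier →ₗ[ℂ] W.carrier), IsCoindPos W C ε := by
  obtain ⟨τ, hinv, hev, hod⟩ := exists_parity W.grading
  have hτ := W.parity_act hev hod
  let ε : ↥(coindSpace W) →ₗ[ℂ] W.carrier := LinearMap.proj [] ∘ₗ (coindSpace W).subtype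
  refine ⟨coind W τ hinv hτ, ε, ?_, ?_, ?_, ?_, ?_⟩
  · intro f hf
    exact (hev _).2 (congrArg (fun g : coindSpace W => g.1 [])
      ((mem_ker_sub_id (coindParity W τ hτ) f).1 hf))
  · intro f hf
    exact (hod _).2 (congrArg (fun g : coindSpace W => g.1 [])
      ((mem_ker_add_id (coindParity W τ hτ) f).1 hf))
  · exact fun x f => f.2.equivar x []
  · exact fun x hx f => f.2.pos_zero x hx []
  · intro M ψ hψe hψo h0 hp
    obtain ⟨ρ, -, hρe, hρo⟩ := exists_parity M.grading
    have hψ : ∀ m, τ (ψ m) = ψ (ρ m) := by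
      intro m
      obtain ⟨c, hc, d, hd, rfl⟩ : ∃ c ∈ M.ev, ∃ d ∈ M.od, c + d = m :=
        Submodule.mem_sup.1 (M.grading.sup_eq_top ▸ Submodule.mem_top)
      simp only [map_add, (hρe c).1 hc, (hρo d).1 hd, (hev _).1 (hψe c hc),
        (hod _).1 (hψo d hd), map_neg]
    have hact : ∀ l m, ρ (M.actListLin (l.map L.parity.σ) m) = M.actListLin l (ρ m) := by
      intro l m
      induction l with
      | nil => rfl
      | cons x l ih =>
        simp only [List.map_cons, SMod.actListLin, LinearMap.comp_apply,
          M.parity_act hρe hρo, L.parity.invol, ih]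
    have hpar : ∀ m, coindParity W τ hτ (toCoind W M ψ h0 hp m) =
        toCoind W M ψ h0 hp (ρ m) := fun m => Subtype.ext <| funext fun l => by
      change τ (ψ _) = ψ _
      rw [hψ, hact]
    refine ⟨⟨toCoind W M ψ h0 hp, fun m hm => ?_, fun m hm => ?_, fun x m => ?_⟩,
      fun m => rfl, fun Φ hΦ => ?_⟩
    · exact (mem_ker_sub_id (coindParity W τ hτ) _).2 ((hpar m).trans
        (congrArg (toCoind W M ψ h0 hp) ((hρe m).1 hm)))
    · exact (mem_ker_add_id (coindParity W τ hτ) _).2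
        ((hpar m).trans ((congrArg (toCoind W M ψ h0 hp) ((hρo m).1 hm)).trans (map_neg _ m)))
    · refine Subtype.ext <| funext fun l => ?_
      change ψ (M.actListLin l _) = ψ (M.actListLin (l ++ [x]) m)
      simp only [SMod.actListLin_apply, SMod.actList_append, SMod.actList]
    · have key : ∀ l m, (Φ.toLin m).1 l = ψ (M.actListLin l m) := by
        intro l
        induction l using List.reverseRecOn with
        | nil => exact fun m => hΦ m
        | append_singleton l x ih =>
          intro m
          have h : (Φ.toLin m).1 (l ++ [x]) = (Φ.toLin (M.act x m)).1 l :=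
            congrArg (fun g : coindSpace W => g.1 l) (Φ.equivar x m).symm
          refine (h.trans (ih _)).trans ?_
          simp only [SMod.actListLin_apply, SMod.actList_append, SMod.actList]
      have hlin : Φ.toLin = toCoind W M ψ h0 hp :=
        LinearMap.ext fun m => Subtype.ext <| funext fun l => key l m
      cases Φ
      cases hlin
      rfl

end Coinduced

section SimpleQuotient

variable {L : GLSA}

/-- If a subspace `Q` is generated by `T` under `𝔤₀` and parity, and
a `𝔤₀`-stable space `U` of odd elements maps `T` into `Q`, then `Q` is `U`-stable. -/
lemma SMod.odd_stable_of_generated (M : SMod L) {τ : M.carrier →ₗ[ℂ] M.carrier}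
    (hτ : ∀ x m, τ (M.act x m) = M.act (L.parity.σ x) (τ m))
    {T Q : Submodule ℂ M.carrier} (hτQ : ∀ q ∈ Q, τ q ∈ Q)
    (h0Q : ∀ x ∈ L.g0, ∀ q ∈ Q, M.act x q ∈ Q)
    (hTQ : T ≤ Q)
    (hmin : ∀ Q' : Submodule ℂ M.carrier, (∀ q ∈ Q', τ q ∈ Q') →
      (∀ x ∈ L.g0, ∀ q ∈ Q', M.act x q ∈ Q') → T ≤ Q' → Q ≤ Q')
    {U : Submodule ℂ L.carrier} (hU : U ≤ L.odd)
    (h0U : ∀ x ∈ L.g0, ∀ y ∈ U, L.bracket x y ∈ U) (hUT : ∀ y ∈ U, ∀ t ∈ T, M.act y t ∈ Q) :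
    ∀ y ∈ U, ∀ q ∈ Q, M.act y q ∈ Q := by
  let R : Submodule ℂ M.carrier := Q ⊓ ⨅ y : U, Q.comap (M.act y)
  have hR : ∀ q, q ∈ R ↔ q ∈ Q ∧ ∀ y ∈ U, M.act y q ∈ Q := fun q => by
    simp [R, Submodule.mem_iInf]
  have hQR : Q ≤ R := by
    refine hmin R (fun q hq => ?_) (fun x hx q hq => ?_)
      (fun t ht => (hR t).2 ⟨hTQ ht, fun y hy => hUT y hy t ht⟩)
    · rw [hR] at hq ⊢
      refine ⟨hτQ q hq.1, fun y hy => ?_⟩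
      have h := hτ (-y) q
      rw [GLSA.parity_odd (neg_mem (hU hy)), neg_neg] at h
      rw [← h]
      exact hτQ _ (hq.2 _ (neg_mem hy))
    · rw [hR] at hq ⊢
      refine ⟨h0Q x hx q hq.1, fun y hy => ?_⟩
      have h := M.act_br_e x y (Or.inl hx) q
      rw [eq_sub_iff_add_eq, ← eq_sub_iff_add_eq'] at h
      rw [h]
      exact sub_mem (h0Q x hx _ (hq.2 y hy)) (hq.2 _ (h0U x hx y hy))
  exact fun y hy q hq => ((hR q).1 (hQR hq)).2 y hy

/-- A finite-dimensional space of odd elements with trivial brackets acts through the span of a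
finite set of anticommuting operators. -/
lemma SMod.exists_finset_anticomm (M : SMod L) (U : Submodule ℂ L.carrier)
    [FiniteDimensional ℂ U] (hU : U ≤ L.odd) (hbr : ∀ x ∈ U, ∀ y ∈ U, L.bracket x y = 0) :
    ∃ s : Finset (M.carrier →ₗ[ℂ] M.carrier),
      (∀ a ∈ s, ∀ b ∈ s, ∀ v, a (b v) = -b (a v)) ∧
      Submodule.span ℂ (s : Set (M.carrier →ₗ[ℂ] M.carrier)) = U.map M.act := by
  obtain ⟨s, hs⟩ := ((Submodule.fg_iff_finiteDimensional U).2 inferInstance).map M.act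
  refine ⟨s, fun a ha b hb v => ?_, hs⟩
  obtain ⟨x, hx, rfl⟩ : a ∈ U.map M.act := hs ▸ Submodule.subset_span ha
  obtain ⟨y, hy, rfl⟩ : b ∈ U.map M.act := hs ▸ Submodule.subset_span hb
  have h := M.act_br_oo x (hU hx) y (hU hy) v
  rw [hbr x hx y hy, map_zero, LinearMap.zero_apply] at h
  exact eq_neg_of_add_eq_zero_left h.symm

/-- A finite-dimensional space of odd elements with trivial brackets generates a
finite-dimensional subspace from a finite-dimensional one. -/
lemma SMod.exists_fg_stable (M : SMod L) (U : Submodule ℂ L.carrier)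
    [FiniteDimensional ℂ U] (hU : U ≤ L.odd) (hbr : ∀ x ∈ U, ∀ y ∈ U, L.bracket x y = 0)
    (T₀ : Submodule ℂ M.carrier) (hT₀ : T₀.FG) :
    ∃ T : Submodule ℂ M.carrier, T.FG ∧ T₀ ≤ T ∧ (∀ x ∈ U, ∀ t ∈ T, M.act x t ∈ T) ∧
      ∀ Q : Submodule ℂ M.carrier, T₀ ≤ Q → (∀ x ∈ U, ∀ q ∈ Q, M.act x q ∈ Q) → T ≤ Q := by
  obtain ⟨s, hs, hspan⟩ := M.exists_finset_anticomm U hU hbr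
  obtain ⟨T, hT, hle, hst, hmin⟩ := _root_.exists_fg_stable s hs T₀ hT₀
  refine ⟨T, hT, hle, fun x hx t ht => ?_, fun Q hQ hQs => hmin Q hQ fun a ha => ?_⟩
  · have hx' : M.act x ∈ Submodule.span ℂ (s : Set (M.carrier →ₗ[ℂ] M.carrier)) :=
      hspan ▸ Submodule.mem_map_of_mem hx
    have hle' : Submodule.span ℂ (s : Set (M.carrier →ₗ[ℂ] M.carrier)) ≤
        T.comap (LinearMap.applyₗ t) := Submodule.span_le.2 fun a ha => hst a ha t ht
    exact hle' hx'
  · obtain ⟨x, hx, rfl⟩ : a ∈ U.map M.act := hspan ▸ Submodule.subset_span ha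
    exact hQs x hx

/-- `𝔤₁ M ≠ M` for every nonzero `M`. -/
lemma SMod.exists_ne_zero_comp_gpos (M : SMod L) [FiniteDimensional ℂ ↥L.gpos]
    [Nontrivial M.carrier] :
    ∃ p : M.carrier →ₗ[ℂ] M.carrier, p ≠ 0 ∧ ∀ x ∈ L.gpos, ∀ m, p (M.act x m) = 0 := by
  obtain ⟨s, hs, hspan⟩ := M.exists_finset_anticomm L.gpos le_sup_right L.br_pp
  obtain ⟨p, hp, hps⟩ := exists_ne_zero_comp_eq_zero s hs
  refine ⟨p, hp, fun x hx m => ?_⟩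
  have hx' : M.act x ∈ Submodule.span ℂ (s : Set (M.carrier →ₗ[ℂ] M.carrier)) :=
    hspan ▸ Submodule.mem_map_of_mem hx
  have hle : Submodule.span ℂ (s : Set (M.carrier →ₗ[ℂ] M.carrier)) ≤
      (LinearMap.ker p).comap (LinearMap.applyₗ m) := Submodule.span_le.2 fun a ha => hps a ha m
  exact hle hx'

/-- A simple `𝔤`-supermodule is generated over `𝔤₀` by a finite-dimensional subspace. -/
lemma SMod.IsSimple.exists_fg_generating {M : SMod L} (hM : M.IsSimple)
    [FiniteDimensional ℂ ↥L.gneg] [FiniteDimensional ℂ ↥L.gpos]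
    {τ : M.carrier →ₗ[ℂ] M.carrier} (hinv : ∀ m, τ (τ m) = m)
    (hev : ∀ m, m ∈ M.ev ↔ τ m = m) (hod : ∀ m, m ∈ M.od ↔ τ m = -m) :
    ∃ T : Submodule ℂ M.carrier, T.FG ∧ ∀ Q : Submodule ℂ M.carrier, (∀ q ∈ Q, τ q ∈ Q) →
      (∀ x ∈ L.g0, ∀ q ∈ Q, M.act x q ∈ Q) → T ≤ Q → Q = ⊤ := by
  obtain ⟨v, -, hv⟩ := Submodule.exists_mem_ne_zero_of_ne_bot hM.1
  obtain ⟨T₁, hT₁, hle₁, hst₁, -⟩ := M.exists_fg_stable L.gpos le_sup_right L.br_pp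
    (Submodule.span ℂ {v}) (Submodule.fg_span_singleton v)
  obtain ⟨T₂, hT₂, hle₂, hst₂, hmin₂⟩ := M.exists_fg_stable L.gneg le_sup_left L.br_nn T₁ hT₁
  refine ⟨T₂, hT₂, ?_⟩
  let S : Set (Submodule ℂ M.carrier) := {Q | (∀ q ∈ Q, τ q ∈ Q) ∧
    (∀ x ∈ L.g0, ∀ q ∈ Q, M.act x q ∈ Q) ∧ T₂ ≤ Q}
  have hτ := M.parity_act hev hod
  have hmin : ∀ Q' : Submodule ℂ M.carrier, (∀ q ∈ Q', τ q ∈ Q') →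
      (∀ x ∈ L.g0, ∀ q ∈ Q', M.act x q ∈ Q') → T₂ ≤ Q' → sInf S ≤ Q' :=
    fun Q' h₁ h₂ h₃ => sInf_le ⟨h₁, h₂, h₃⟩
  have hτS : ∀ q ∈ sInf S, τ q ∈ sInf S := fun q hq =>
    Submodule.mem_sInf.2 fun Q hQ => hQ.1 q (Submodule.mem_sInf.1 hq Q hQ)
  have h0S : ∀ x ∈ L.g0, ∀ q ∈ sInf S, M.act x q ∈ sInf S := fun x hx q hq =>
    Submodule.mem_sInf.2 fun Q hQ => hQ.2.1 x hx q (Submodule.mem_sInf.1 hq Q hQ)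
  have hTS : T₂ ≤ sInf S := le_sInf fun Q hQ => hQ.2.2
  have hneg := M.odd_stable_of_generated hτ hτS h0S hTS hmin (U := L.gneg) le_sup_left L.br_0n
    fun y hy t ht => hTS (hst₂ y hy t ht)
  have hpos := M.odd_stable_of_generated hτ hτS h0S hTS hmin (U := L.gpos) le_sup_right L.br_0p
    (by
      let R : Submodule ℂ M.carrier := sInf S ⊓ ⨅ x : L.gpos, (sInf S).comap (M.act x)
      have hR : ∀ q, q ∈ R ↔ q ∈ sInf S ∧ ∀ x ∈ L.gpos, M.act x q ∈ sInf S := fun q => by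
        simp only [R, Submodule.mem_inf, Submodule.mem_iInf, Submodule.mem_comap,
          Subtype.forall]
      have hTR : T₂ ≤ R := hmin₂ R
        (fun t ht => (hR t).2 ⟨hTS (hle₂ ht), fun x hx => hTS (hle₂ (hst₁ x hx t ht))⟩)
        (fun y hy q hq => by
          rw [hR] at hq ⊢
          refine ⟨hneg y hy q hq.1, fun x hx => ?_⟩
          have h := M.act_br_oo x (Submodule.mem_sup_right hx) y (Submodule.mem_sup_left hy) q
          rw [← sub_eq_iff_eq_add] at h
          rw [← h]
          exact sub_mem (h0S _ (L.br_pn x hx y hy) q hq.1) (hneg y hy _ (hq.2 x hx)))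
      exact fun x hx t ht => ((hR t).1 (hTR ht)).2 x hx)
  have hsub : M.IsSubmod (sInf S) := by
    refine ⟨fun x m hm => ?_, le_inf_sup_inf hinv hev hod hτS⟩
    obtain ⟨a, ha, b, hb, rfl⟩ := L.exists_add x
    obtain ⟨c, hc, d, hd, rfl⟩ := Submodule.mem_sup.1 hb
    simp only [map_add, LinearMap.add_apply]
    exact add_mem (h0S a ha m hm) (add_mem (hneg c hc m hm) (hpos d hd m hm))
  have htop : sInf S = ⊤ := (hM.2 _ hsub).resolve_left fun hbot => hv <| by
    have : v ∈ sInf S := hTS (hle₂ (hle₁ (Submodule.mem_span_singleton_self v)))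
    simpa [hbot] using this
  exact fun Q h₁ h₂ h₃ => top_le_iff.1 (htop ▸ hmin Q h₁ h₂ h₃)

/-- The quotient of a `𝔤`-supermodule by a graded `𝔤₀`-submodule. -/
def SMod.quot0 (M : SMod L) (P : Submodule ℂ M.carrier) {τ : M.carrier →ₗ[ℂ] M.carrier}
    (hinv : ∀ m, τ (τ m) = m) (hτ : ∀ x m, τ (M.act x m) = M.act (L.parity.σ x) (τ m))
    (hτP : P ≤ P.comap τ) (h0P : ∀ x : L.g0, P ≤ P.comap (M.act x)) : SMod0 L where
  carrier := M.carrier ⧸ P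
  act :=
    { toFun := fun x => P.mapQ P (M.act x) (h0P x)
      map_add' := fun x y => Submodule.linearMap_qext _ <| LinearMap.ext fun m => by simp
      map_smul' := fun c x => Submodule.linearMap_qext _ <| LinearMap.ext fun m => by simp }
  ev := LinearMap.ker (P.mapQ P τ hτP - LinearMap.id)
  od := LinearMap.ker (P.mapQ P τ hτP + LinearMap.id)
  grading := isCompl_ker_sub_ker_add fun m => by
    obtain ⟨m, rfl⟩ := P.mkQ_surjective m
    simp [hinv]
  act_ev x m hm := by
    obtain ⟨m, rfl⟩ := P.mkQ_surjective m
    simp only [LinearMap.mem_ker, LinearMap.sub_apply, LinearMap.id_apply, sub_eq_zero,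
      Submodule.mkQ_apply, Submodule.mapQ_apply, LinearMap.coe_mk, AddHom.coe_mk] at hm ⊢
    rw [hτ, GLSA.parity_g0 x.2, ← Submodule.mapQ_apply P P (M.act x) (h := h0P x), hm,
      Submodule.mapQ_apply]
  act_od x m hm := by
    obtain ⟨m, rfl⟩ := P.mkQ_surjective m
    simp only [LinearMap.mem_ker, LinearMap.add_apply, LinearMap.id_apply,
      add_eq_zero_iff_eq_neg,
      Submodule.mkQ_apply, Submodule.mapQ_apply, LinearMap.coe_mk, AddHom.coe_mk] at hm ⊢
    rw [hτ, GLSA.parity_g0 x.2, ← Submodule.mapQ_apply P P (M.act x) (h := h0P x), hm,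
      map_neg, Submodule.mapQ_apply]
  act_br x y m := by
    obtain ⟨m, rfl⟩ := P.mkQ_surjective m
    simp only [LinearMap.coe_mk, AddHom.coe_mk, Submodule.mkQ_apply, Submodule.mapQ_apply,
      M.act_br_e x y (Or.inl x.2), Submodule.Quotient.mk_sub]

/-- A simple `𝔤`-supermodule has a simple `𝔤≥0`-quotient on which `𝔤₁` acts by zero. -/
lemma SMod.IsSimple.exists_simple_quotient {M : SMod L} (hM : M.IsSimple)
    [FiniteDimensional ℂ ↥L.gneg] [FiniteDimensional ℂ ↥L.gpos] :
    ∃ (N : SMod0 L) (ψ : M.carrier →ₗ[ℂ] N.carrier), N.IsSimple ∧ Surjective ψ ∧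
      (∀ m ∈ M.ev, ψ m ∈ N.ev) ∧ (∀ m ∈ M.od, ψ m ∈ N.od) ∧
      (∀ (x : L.g0) (m : M.carrier), ψ (M.act ↑x m) = N.act x (ψ m)) ∧
      (∀ x ∈ L.gpos, ∀ m : M.carrier, ψ (M.act x m) = 0) := by
  obtain ⟨τ, hinv, hev, hod⟩ := exists_parity M.grading
  have hτ := M.parity_act hev hod
  obtain ⟨T, hT, hgen⟩ := hM.exists_fg_generating hinv hev hod
  have : Nontrivial M.carrier := by
    obtain ⟨v, -, hv⟩ := Submodule.exists_mem_ne_zero_of_ne_bot hM.1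
    exact ⟨v, 0, hv⟩
  obtain ⟨p, hp, hpz⟩ := M.exists_ne_zero_comp_gpos
  let E : Set (M.carrier →ₗ[ℂ] M.carrier) := {a | a = τ ∨ ∃ x ∈ L.g0, a = M.act x}
  have hE : ∀ Q : Submodule ℂ M.carrier, (∀ a ∈ E, ∀ q ∈ Q, a q ∈ Q) ↔
      (∀ q ∈ Q, τ q ∈ Q) ∧ ∀ x ∈ L.g0, ∀ q ∈ Q, M.act x q ∈ Q := by
    refine fun Q => ⟨fun h => ⟨h τ (Or.inl rfl), fun x hx => h _ (Or.inr ⟨x, hx, rfl⟩)⟩, ?_⟩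
    rintro ⟨h₁, h₂⟩ a (rfl | ⟨x, hx, rfl⟩)
    exacts [h₁, h₂ x hx]
  let G : Submodule ℂ M.carrier := Submodule.span ℂ {m | ∃ x ∈ L.gpos, ∃ n, M.act x n = m}
  have hGp : G ≤ LinearMap.ker p := by
    refine Submodule.span_le.2 ?_
    rintro _ ⟨x, hx, n, rfl⟩
    exact hpz x hx n
  have hG : ∀ a ∈ E, ∀ q ∈ G, a q ∈ G := by
    refine (hE G).2 ⟨fun q hq => ?_, fun x hx q hq => ?_⟩
    · have : G ≤ G.comap τ := by
        refine Submodule.span_le.2 ?_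
        rintro _ ⟨x, hx, n, rfl⟩
        refine Submodule.subset_span ⟨-x, neg_mem hx, τ n, ?_⟩
        rw [hτ, GLSA.parity_odd (Submodule.mem_sup_right hx)]
      exact this hq
    · have : G ≤ G.comap (M.act x) := by
        refine Submodule.span_le.2 ?_
        rintro _ ⟨y, hy, n, rfl⟩
        have h := M.act_br_e x y (Or.inl hx) n
        rw [eq_sub_iff_add_eq] at h
        change M.act x (M.act y n) ∈ G
        rw [← h]
        exact add_mem (Submodule.subset_span ⟨_, L.br_0p x hx y hy, n, rfl⟩)
          (Submodule.subset_span ⟨y, hy, _, rfl⟩)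
      exact this hq
  obtain ⟨P, hP, hGP, hPtop, hPmax⟩ := exists_maximal_stable E hT
    (fun Q hQ => hgen Q ((hE Q).1 hQ).1 ((hE Q).1 hQ).2) hG
    (fun h => hp (LinearMap.ker_eq_top.1 (top_le_iff.1 (h ▸ hGp))))
  rw [hE] at hP
  let N : SMod0 L := M.quot0 P hinv hτ hP.1 fun x => hP.2 x x.2
  have hNev : ∀ m : M.carrier ⧸ P, m ∈ N.ev ↔ P.mapQ P τ hP.1 m = m :=
    mem_ker_sub_id (P.mapQ P τ hP.1)
  have hNod : ∀ m : M.carrier ⧸ P, m ∈ N.od ↔ P.mapQ P τ hP.1 m = -m :=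
    mem_ker_add_id (P.mapQ P τ hP.1)
  refine ⟨N, P.mkQ, ⟨?_, fun Q hQ => ?_⟩, P.mkQ_surjective, fun m hm => ?_, fun m hm => ?_,
    fun x m => rfl, fun x hx m => ?_⟩
  · have : Nontrivial (M.carrier ⧸ P) := Submodule.Quotient.nontrivial_iff.2 hPtop
    exact top_ne_bot (α := Submodule ℂ (M.carrier ⧸ P))
  · let Q₁ : Submodule ℂ (M.carrier ⧸ P) := Q
    have hQ' : ∀ a ∈ E, ∀ q ∈ Q₁.comap P.mkQ, a q ∈ Q₁.comap P.mkQ :=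
      (hE _).2 ⟨fun q hq => parity_mem_of_le hNev hNod hQ.2 (P.mkQ q) hq,
        fun x hx q hq => hQ.1 ⟨x, hx⟩ (P.mkQ q) hq⟩
    have hmap : (Q₁.comap P.mkQ).map P.mkQ = Q₁ :=
      Submodule.map_comap_eq_of_surjective P.mkQ_surjective Q₁
    refine (hPmax _ hQ' (Submodule.le_comap_mkQ P Q₁)).imp (fun h => ?_) (fun h => ?_)
    · rw [h] at hmap
      exact hmap.symm.trans (Submodule.mkQ_map_self P)
    · rw [h, Submodule.map_top, Submodule.range_mkQ] at hmap
      exact hmap.symm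
  · exact (hNev _).2 (congrArg P.mkQ ((hev m).1 hm))
  · exact (hNod _).2 ((congrArg P.mkQ ((hod m).1 hm)).trans (map_neg P.mkQ m))
  · exact (Submodule.Quotient.mk_eq_zero P).2 (hGP (Submodule.subset_span ⟨x, hx, m, rfl⟩))

/-- The kernel of a homomorphism is a sub-supermodule. -/
lemma SHom.isSubmod_ker {M C : SMod L} (f : SHom M C) :
    M.IsSubmod (LinearMap.ker f.toLin) := by
  refine ⟨fun x m hm => ?_, fun m hm => ?_⟩
  · rw [LinearMap.mem_ker] at hm ⊢
    rw [f.equivar, hm, map_zero]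
  · obtain ⟨c, hc, d, hd, rfl⟩ : ∃ c ∈ M.ev, ∃ d ∈ M.od, c + d = m :=
      Submodule.mem_sup.1 (M.grading.sup_eq_top ▸ Submodule.mem_top)
    rw [LinearMap.mem_ker, map_add] at hm
    have hfc : f.toLin c = 0 := Submodule.disjoint_def.1 C.grading.disjoint _ (f.map_ev c hc)
      (by rw [eq_neg_of_add_eq_zero_left hm]; exact neg_mem (f.map_od d hd))
    rw [hfc, zero_add] at hm
    exact Submodule.mem_sup.2 ⟨c, ⟨hfc, hc⟩, d, ⟨hm, hd⟩, rfl⟩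

end SimpleQuotient

/-- Let `M` be a simple `𝔤`-supermodule.  Then there exists a simple
`𝔤₀`-supermodule `N` such that `M` embeds as a `𝔤`-supermodule into the coinduced
module `Coind_{𝔤≥0}^𝔤(N)`. -/
theorem statement_7 (L : GLSA)
    [FiniteDimensional ℂ ↥L.gneg] [FiniteDimensional ℂ ↥L.gpos]
    (M : SMod L) (hM : M.IsSimple) :
    ∃ N : SMod0 L, N.IsSimple ∧
      ∃ (C : SMod L) (ε : C.carrier →ₗ[ℂ] N.carrier), IsCoindPos N C ε ∧
        ∃ f : SHom M C, Injective f.toLin := by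
  obtain ⟨N, ψ, hN, hsurj, hev, hod, h0, hp⟩ := hM.exists_simple_quotient
  obtain ⟨C, ε, hC⟩ := exists_isCoindPos N
  obtain ⟨f, hf, -⟩ := hC.universal M ψ hev hod h0 hp
  refine ⟨N, hN, C, ε, hC, f, LinearMap.ker_eq_bot.1 ?_⟩
  refine (hM.2 _ f.isSubmod_ker).resolve_right fun htop => hN.1 ?_
  refine (Submodule.eq_bot_iff _).2 fun n _ => ?_
  obtain ⟨m, rfl⟩ := hsurj n
  have hm : f.toLin m = 0 := LinearMap.mem_ker.1 (htop ▸ Submodule.mem_top)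
  rw [← hf m, hm, map_zero]
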